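/- arXiv:2203.17245 — 5 statements merged into one kernel-verified Lean document; each statement's English description precedes it below -/
import Mathlib

section
/- For every integer p ≥ 3, the series Σ_{n=0}^{∞} t_{n,p}·(27/256)^n converges and its sum equals Z(p) = (1/(p(2p−3)))·(16/9)^{p−2}·binom(2(p−1), p−1). -/
open Filter Real

/-- Brown's formula for the number of simple triangulations of the `p`-gon with
`n` inner vertices. -/
noncomputable def tcount (n p : ℕ) : ℝ :=
  (2 * (2 * p - 3).factorial : ℝ) / ((p - 1).factorial * (p - 3).factorial : ℝ) *
    (((4 * n + 2 * p - 5).factorial : ℝ) / ((n.factorial * (3 * n + 2 * p - 3).factorial : ℝ)))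

/-- `Z(p) = (1/(p(2p−3)))·(16/9)^{p−2}·binom(2(p−1), p−1)`. -/
noncomputable def Z (p : ℕ) : ℝ :=
  1 / ((p : ℝ) * (2 * (p : ℝ) - 3)) * (16 / 9) ^ (p - 2) *
    (Nat.choose (2 * (p - 1)) (p - 1) : ℝ)

/-- The Raney numbers `r / (4 n + r) * binom (4 n + r) n`: the coefficient of `x ^ n` in `B ^ r`,
where `B = 1 + x * B ^ 4`. -/
def raney : ℕ → ℕ → ℕ
  | _, 0 => 1
  | 0, _ + 1 => 0
  | r + 1, n + 1 => raney r (n + 1) + raney (r + 4) n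
termination_by r n => (n, r)

theorem raney_zero_right (r : ℕ) : raney r 0 = 1 := by
  cases r <;> simp [raney]

theorem raney_zero_succ (n : ℕ) : raney 0 (n + 1) = 0 := by
  simp [raney]

theorem raney_succ_succ (r n : ℕ) :
    raney (r + 1) (n + 1) = raney r (n + 1) + raney (r + 4) n := by
  rw [raney]

theorem raney_succ_mul_factorial (n : ℕ) : ∀ r : ℕ,
    raney (r + 1) n * (n.factorial * (3 * n + r + 1).factorial) =
      (r + 1) * (4 * n + r).factorial := by
  induction n with
  | zero => intro r; simp [raney_zero_right, Nat.factorial_succ]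
  | succ n ihn =>
    intro r
    induction r with
    | zero =>
      have h := ihn 3
      rw [raney_succ_succ, raney_zero_succ]
      rw [show 3 * (n + 1) + 0 + 1 = 3 * n + 3 + 1 by ring,
        show 4 * (n + 1) + 0 = (4 * n + 3) + 1 by ring, Nat.factorial_succ n,
        Nat.factorial_succ (4 * n + 3)]
      linear_combination (n + 1) * h
    | succ r ihr =>
      have h := ihn (r + 4)
      rw [raney_succ_succ]
      rw [show 3 * n + (r + 4) + 1 = (3 * n + r + 4) + 1 by ring,
        show 4 * n + (r + 4) = 4 * n + r + 4 by ring, Nat.factorial_succ (3 * n + r + 4)] at h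
      rw [show 3 * (n + 1) + r + 1 = 3 * n + r + 4 by ring,
        show 4 * (n + 1) + r = 4 * n + r + 4 by ring, Nat.factorial_succ n] at ihr
      rw [show 3 * (n + 1) + (r + 1) + 1 = (3 * n + r + 4) + 1 by ring,
        show 4 * (n + 1) + (r + 1) = (4 * n + r + 4) + 1 by ring, Nat.factorial_succ n,
        Nat.factorial_succ (3 * n + r + 4), Nat.factorial_succ (4 * n + r + 4)]
      rw [show r + 1 + 4 = r + 4 + 1 by ring]
      linear_combination (n + 1) * h + (3 * n + r + 5) * ihr

theorem raney_succ_eq_div (r n : ℕ) :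
    (raney (r + 1) n : ℝ) =
      (r + 1) * (4 * n + r).factorial / (n.factorial * (3 * n + r + 1).factorial) := by
  rw [eq_div_iff (by positivity)]
  exact_mod_cast raney_succ_mul_factorial n r

theorem sum_range_raney_le (N : ℕ) : ∀ r : ℕ,
    ∑ n ∈ Finset.range N, (raney r n : ℝ) * (27 / 256) ^ n ≤ (4 / 3) ^ r := by
  induction N with
  | zero => intro r; simp; positivity
  | succ N ihN =>
    intro r
    induction r with
    | zero => simp [Finset.sum_range_succ', raney_zero_succ, raney_zero_right]
    | succ r ihr =>
      have h := ihN (r + 4)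
      rw [Finset.sum_range_succ'] at ihr ⊢
      have hs : ∑ n ∈ Finset.range N, (raney (r + 1) (n + 1) : ℝ) * (27 / 256) ^ (n + 1) =
          ∑ n ∈ Finset.range N, (raney r (n + 1) : ℝ) * (27 / 256) ^ (n + 1) +
          27 / 256 * ∑ n ∈ Finset.range N, (raney (r + 4) n : ℝ) * (27 / 256) ^ n := by
        rw [Finset.mul_sum, ← Finset.sum_add_distrib]
        refine Finset.sum_congr rfl fun n _ => ?_
        rw [raney_succ_succ]; push_cast; ring
      rw [hs]
      simp only [raney_zero_right] at ihr ⊢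
      have e₁ : (4 / 3 : ℝ) ^ (r + 4) = 256 / 81 * (4 / 3) ^ r := by ring
      have e₂ : (4 / 3 : ℝ) ^ (r + 1) = 4 / 3 * (4 / 3) ^ r := by ring
      linarith

theorem summable_raney (r : ℕ) : Summable fun n : ℕ => (raney r n : ℝ) * (27 / 256) ^ n :=
  summable_of_sum_range_le (fun _ => by positivity) fun N => sum_range_raney_le N r

theorem tsum_raney_succ (r : ℕ) :
    ∑' n : ℕ, (raney (r + 1) n : ℝ) * (27 / 256) ^ n =
      ∑' n : ℕ, (raney r n : ℝ) * (27 / 256) ^ n +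
        27 / 256 * ∑' n : ℕ, (raney (r + 4) n : ℝ) * (27 / 256) ^ n := by
  have hr : Summable fun n : ℕ => (raney r (n + 1) : ℝ) * (27 / 256) ^ (n + 1) :=
    (summable_nat_add_iff 1).2 (summable_raney r)
  rw [(summable_raney (r + 1)).tsum_eq_zero_add, (summable_raney r).tsum_eq_zero_add,
    ← tsum_mul_left, add_assoc, ← hr.tsum_add ((summable_raney (r + 4)).mul_left _)]
  simp only [raney_zero_right]
  congr 1
  refine tsum_congr fun n => ?_
  rw [raney_succ_succ]; push_cast; ring

/-- A bounded function on `ℕ` that vanishes at `0` and is harmonic at the positive integers, for the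
random walk with steps `-1` (probability `3 / 4`) and `3` (probability `1 / 4`), is zero. -/
theorem eq_zero_of_harmonic {d : ℕ → ℝ} (h : ∀ r, d (r + 1) = 3 / 4 * d r + 1 / 4 * d (r + 4))
    (hd₀ : ∀ r, 0 ≤ d r) (hd₁ : ∀ r, d r ≤ 1) (hzero : d 0 = 0) (r : ℕ) : d r = 0 := by
  set L : ℝ := d 3 + d 2 + d 1 - 3 * d 0 with hL
  have hinv : ∀ r, d (r + 3) + d (r + 2) + d (r + 1) - 3 * d r = L := by
    intro r
    induction r with
    | zero => simp [hL]
    | succ r ih =>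
      rw [show r + 1 + 3 = r + 4 by ring, show r + 1 + 2 = r + 3 by ring,
        show r + 1 + 1 = r + 2 by ring]
      linarith [h r]
  have hsum : ∀ N : ℕ, N * L = d (N + 2) + 2 * d (N + 1) + 3 * d N - d 2 - 2 * d 1 - 3 * d 0 := by
    intro N
    induction N with
    | zero => simp; ring
    | succ N ih =>
      rw [show N + 1 + 2 = N + 3 by ring, show N + 1 + 1 = N + 2 by ring]
      push_cast
      linarith [hinv N]
  have hL0 : L = 0 := by
    by_contra hne
    obtain ⟨N, hN⟩ := exists_nat_gt (6 / |L|)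
    rw [div_lt_iff₀ (abs_pos.2 hne)] at hN
    have : |(N : ℝ) * L| ≤ 6 := by
      rw [hsum N, abs_le]
      constructor <;>
        linarith [hd₀ 0, hd₀ 1, hd₀ 2, hd₀ N, hd₀ (N + 1), hd₀ (N + 2),
          hd₁ 0, hd₁ 1, hd₁ 2, hd₁ N, hd₁ (N + 1), hd₁ (N + 2)]
    rw [abs_mul, Nat.abs_cast] at this
    linarith
  set Q : ℕ → ℝ := fun r => (d (r + 2) - d r) ^ 2 + 2 * (d (r + 1) - d r) ^ 2 with hQ
  have hQ_succ : ∀ r, Q (r + 1) = 3 * Q r := by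
    intro r
    have e : d (r + 3) = 3 * d r - d (r + 2) - d (r + 1) := by linarith [hinv r]
    simp only [hQ]
    rw [show r + 1 + 2 = r + 3 by ring, show r + 1 + 1 = r + 2 by ring, e]
    ring
  have hQ_pow : ∀ r, Q r = 3 ^ r * Q 0 := by
    intro r
    induction r with
    | zero => simp
    | succ r ih => rw [hQ_succ, ih]; ring
  have hQ_le : ∀ r, Q r ≤ 3 := by
    intro r
    have h₁ : (d (r + 2) - d r) ^ 2 ≤ 1 := by
      rw [sq_le_one_iff_abs_le_one, abs_le]
      constructor <;> linarith [hd₀ r, hd₁ r, hd₀ (r + 2), hd₁ (r + 2)]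
    have h₂ : (d (r + 1) - d r) ^ 2 ≤ 1 := by
      rw [sq_le_one_iff_abs_le_one, abs_le]
      constructor <;> linarith [hd₀ r, hd₁ r, hd₀ (r + 1), hd₁ (r + 1)]
    simp only [hQ]
    linarith
  have hQ0 : Q 0 = 0 := by
    have hnn : 0 ≤ Q 0 := by simp only [hQ]; positivity
    by_contra hne
    have hpos : 0 < Q 0 := lt_of_le_of_ne hnn (Ne.symm hne)
    obtain ⟨N, hN⟩ := pow_unbounded_of_one_lt (3 / Q 0) (by norm_num : (1 : ℝ) < 3)
    rw [div_lt_iff₀ hpos, ← hQ_pow] at hN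
    linarith [hQ_le N]
  induction r with
  | zero => exact hzero
  | succ r ih =>
    have h₀ : Q r = 0 := by rw [hQ_pow, hQ0, mul_zero]
    simp only [hQ] at h₀
    have h₁ : (d (r + 1) - d r) ^ 2 = 0 := by
      nlinarith [sq_nonneg (d (r + 2) - d r), sq_nonneg (d (r + 1) - d r)]
    linarith [(pow_eq_zero_iff two_ne_zero).1 h₁]

theorem hasSum_raney (r : ℕ) :
    HasSum (fun n : ℕ => (raney r n : ℝ) * (27 / 256) ^ n) ((4 / 3) ^ r) := by
  set F : ℕ → ℝ := fun r => ∑' n : ℕ, (raney r n : ℝ) * (27 / 256) ^ n with hF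
  have hF_nonneg : ∀ r, 0 ≤ F r := fun r => tsum_nonneg fun _ => by positivity
  have hF_le : ∀ r, F r ≤ (4 / 3) ^ r := fun r =>
    Real.tsum_le_of_sum_range_le (fun _ => by positivity) fun N => sum_range_raney_le N r
  have hF_zero : F 0 = 1 := by
    simp only [hF]
    rw [(summable_raney 0).tsum_eq_zero_add]
    simp [raney_zero_succ, raney_zero_right]
  have hB : ∀ r : ℕ, (0 : ℝ) < (4 / 3) ^ r := fun r => by positivity
  have key : 1 - F r / (4 / 3) ^ r = 0 := by
    refine eq_zero_of_harmonic (d := fun r => 1 - F r / (4 / 3) ^ r) (fun r => ?_) (fun r => ?_)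
      (fun r => ?_) ?_ r
    · have hrec : F (r + 1) = F r + 27 / 256 * F (r + 4) := tsum_raney_succ r
      have := (hB r).ne'
      simp only [hrec, pow_add]
      field_simp
      ring
    · exact sub_nonneg.2 ((div_le_one (hB r)).2 (hF_le r))
    · exact sub_le_self _ (div_nonneg (hF_nonneg r) (hB r).le)
    · simp [hF_zero]
  have hFr : F r = (4 / 3) ^ r := by
    rw [sub_eq_zero, eq_comm, div_eq_one_iff_eq (hB r).ne'] at key
    exact key
  rw [← hFr]
  exact (summable_raney r).hasSum

theorem tcount_add_three (n q : ℕ) :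
    tcount n (q + 3) = (2 * (2 * q + 3).factorial : ℝ) / ((q + 2).factorial * q.factorial) *
      ((4 * (raney (2 * q + 2) n / (2 * q + 2)) - 3 * (raney (2 * q + 3) n / (2 * q + 3))) /
        (2 * q + 6)) := by
  rw [raney_succ_eq_div (2 * q + 1), raney_succ_eq_div (2 * q + 2), tcount,
    show 2 * (q + 3) - 3 = 2 * q + 3 by lia, show q + 3 - 1 = q + 2 by lia,
    show q + 3 - 3 = q by lia, show 4 * n + 2 * (q + 3) - 5 = 4 * n + (2 * q + 1) by lia,
    show 3 * n + 2 * (q + 3) - 3 = 3 * n + (2 * q + 1) + 1 + 1 by lia,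
    show 4 * n + (2 * q + 2) = 4 * n + (2 * q + 1) + 1 by lia,
    show 3 * n + (2 * q + 2) + 1 = 3 * n + (2 * q + 1) + 1 + 1 by lia,
    Nat.factorial_succ (3 * n + (2 * q + 1) + 1), Nat.factorial_succ (4 * n + (2 * q + 1))]
  congr 1
  push_cast
  have h₁ : (2 * q + 1 + 1 : ℝ) ≠ 0 := by positivity
  have h₂ : (2 * q + 2 + 1 : ℝ) ≠ 0 := by positivity
  field_simp
  ring

theorem Z_add_three (q : ℕ) :
    Z (q + 3) = (2 * (2 * q + 3).factorial : ℝ) / ((q + 2).factorial * q.factorial) *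
      ((4 * ((4 / 3) ^ (2 * q + 2) / (2 * q + 2)) - 3 * ((4 / 3) ^ (2 * q + 3) / (2 * q + 3))) /
        (2 * q + 6)) := by
  have hpow : (4 / 3 : ℝ) ^ (2 * q + 2) = (16 / 9) ^ (q + 1) := by
    rw [show 2 * q + 2 = 2 * (q + 1) by ring, pow_mul]; norm_num
  rw [pow_succ _ (2 * q + 2), hpow, Z, show q + 3 - 2 = q + 1 by lia,
    show q + 3 - 1 = q + 2 by lia, Nat.cast_choose ℝ (by lia : q + 2 ≤ 2 * (q + 2)),
    show 2 * (q + 2) - (q + 2) = q + 2 by lia, show 2 * (q + 2) = 2 * q + 3 + 1 by ring,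
    Nat.factorial_succ (2 * q + 3), Nat.factorial_succ (q + 1), Nat.factorial_succ q]
  push_cast
  have h₁ : (2 * (q + 3 : ℝ) - 3) = 2 * q + 3 := by ring
  rw [h₁]
  field_simp
  ring

/-- For every `p ≥ 3`, the series `Σ_{n≥0} t_{n,p}·(27/256)^n` converges with sum `Z(p)`. -/
theorem tcount_generating_series (p : ℕ) (hp : 3 ≤ p) :
    HasSum (fun n : ℕ => tcount n p * (27 / 256 : ℝ) ^ n) (Z p) := by
  obtain ⟨q, rfl⟩ := Nat.exists_eq_add_of_le' hp
  rw [Z_add_three]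
  have h := (((((hasSum_raney (2 * q + 2)).div_const (2 * q + 2 : ℝ)).mul_left 4).sub
    (((hasSum_raney (2 * q + 3)).div_const (2 * q + 3 : ℝ)).mul_left 3)).div_const
      (2 * q + 6 : ℝ)).mul_left
        ((2 * (2 * q + 3).factorial : ℝ) / ((q + 2).factorial * q.factorial))
  refine h.congr_fun fun n => ?_
  rw [tcount_add_three]
  ring
end

section
/- There exists a constant c > 0, independent of p and n, such that for every integer n ≥ 1 and every integer p ≥ 1, one has q_{n,p} ≤ c·C(p)·n^{−3/2}·(256/27)^n. -/
open Filter Real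

/-- Brown's formula for the number of quasi-simple triangulations of the `p`-gon with
`n` inner vertices. -/
noncomputable def qcount (n p : ℕ) : ℝ :=
  ((2 * p).factorial * (4 * n + 2 * p - 5).factorial : ℝ) /
    (((p - 1).factorial * p.factorial * (n - 1).factorial
      * (3 * n + 2 * p - 3).factorial : ℕ) : ℝ)

/-- `C(p) = (√3/(32·√(2π)))·p·binom(2p, p)·(16/9)^{p−1}`. -/
noncomputable def C (p : ℕ) : ℝ :=
  Real.sqrt 3 / (32 * Real.sqrt (2 * Real.pi)) * (p : ℝ) *
    (Nat.choose (2 * p) p : ℝ) * (16 / 9) ^ (p - 1)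

/-- The part of Brown's formula that depends jointly on both parameters, written in terms of
`m = n - 1` and `k = p - 1`. -/
noncomputable def jointFactor (m k : ℕ) : ℝ :=
  ((4 * m + 2 * k + 1).factorial : ℝ) / (m.factorial * (3 * m + 2 * k + 2).factorial)

theorem jointFactor_nonneg (m k : ℕ) : 0 ≤ jointFactor m k := by
  unfold jointFactor; positivity

theorem jointFactor_succ_right (m k : ℕ) :
    jointFactor m (k + 1) = jointFactor m k *
      ((4 * m + 2 * k + 3) * (4 * m + 2 * k + 2) / ((3 * m + 2 * k + 4) * (3 * m + 2 * k + 3))) := by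
  have h₁ : 4 * m + 2 * (k + 1) + 1 = (4 * m + 2 * k + 1) + 1 + 1 := by ring
  have h₂ : 3 * m + 2 * (k + 1) + 2 = (3 * m + 2 * k + 2) + 1 + 1 := by ring
  unfold jointFactor
  rw [h₁, h₂]
  simp only [Nat.factorial_succ (_ + 1), Nat.factorial_succ (4 * m + 2 * k),
    Nat.factorial_succ (3 * m + 2 * k)]
  push_cast
  field_simp
  ring

theorem jointFactor_succ_left (m : ℕ) :
    jointFactor (m + 1) 0 = jointFactor m 0 *
      ((4 * m + 5) * (4 * m + 4) * (4 * m + 3) * (4 * m + 2) /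
        ((m + 1) * ((3 * m + 5) * (3 * m + 4) * (3 * m + 3)))) := by
  have h₁ : 4 * (m + 1) + 2 * 0 + 1 = (4 * m + 1) + 1 + 1 + 1 + 1 := by ring
  have h₂ : 3 * (m + 1) + 2 * 0 + 2 = (3 * m + 2) + 1 + 1 + 1 := by ring
  unfold jointFactor
  rw [h₁, h₂]
  simp only [Nat.factorial_succ, mul_zero, add_zero]
  push_cast
  field_simp
  ring

theorem jointFactor_le_pow_mul (m k : ℕ) :
    jointFactor m k ≤ (16 / 9) ^ k * jointFactor m 0 := by
  induction k with
  | zero => simp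
  | succ k ih =>
    have hratio : ((4 * m + 2 * k + 3) * (4 * m + 2 * k + 2) /
        ((3 * m + 2 * k + 4) * (3 * m + 2 * k + 3)) : ℝ) ≤ 16 / 9 := by
      rw [div_le_div_iff₀ (by positivity) (by norm_num)]
      have hm : (0 : ℝ) ≤ m := m.cast_nonneg
      have hk : (0 : ℝ) ≤ k := k.cast_nonneg
      nlinarith [mul_nonneg hm hk, mul_nonneg hk hk]
    rw [jointFactor_succ_right]
    calc _ ≤ (16 / 9) ^ k * jointFactor m 0 * (16 / 9) := by
          have := jointFactor_nonneg m 0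
          gcongr
      _ = _ := by ring

theorem sq_jointFactor_zero_mul_le (m : ℕ) :
    jointFactor m 0 ^ 2 * (m + 1 : ℝ) ^ 3 ≤ ((256 / 27) ^ m) ^ 2 := by
  induction m with
  | zero => norm_num [jointFactor]
  | succ m ih =>
    have hm : (0 : ℝ) ≤ m := m.cast_nonneg
    set r : ℝ := (4 * m + 5) * (4 * m + 4) * (4 * m + 3) * (4 * m + 2) /
      ((m + 1) * ((3 * m + 5) * (3 * m + 4) * (3 * m + 3)))
    have hr : r ^ 2 * (m + 2 : ℝ) ^ 3 ≤ (256 / 27) ^ 2 * (m + 1) ^ 3 := by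
      simp only [r]
      rw [div_pow, div_mul_eq_mul_div, div_le_iff₀ (by positivity), ← sub_nonneg]
      ring_nf
      positivity
    rw [jointFactor_succ_left]
    push_cast
    calc (jointFactor m 0 * r) ^ 2 * (m + 1 + 1 : ℝ) ^ 3
        = jointFactor m 0 ^ 2 * (r ^ 2 * (m + 2 : ℝ) ^ 3) := by ring
      _ ≤ jointFactor m 0 ^ 2 * ((256 / 27) ^ 2 * (m + 1) ^ 3) := by gcongr
      _ = jointFactor m 0 ^ 2 * (m + 1 : ℝ) ^ 3 * (256 / 27) ^ 2 := by ring
      _ ≤ ((256 / 27) ^ m) ^ 2 * (256 / 27) ^ 2 := by gcongr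
      _ = _ := by ring

theorem jointFactor_zero_le (m : ℕ) :
    jointFactor m 0 ≤ (m + 1 : ℝ) ^ (-(3 : ℝ) / 2) * (256 / 27) ^ m := by
  have hm : (0 : ℝ) < m + 1 := by positivity
  refine le_of_sq_le_sq ?_ (by positivity)
  have hpow : ((m + 1 : ℝ) ^ (-(3 : ℝ) / 2)) ^ 2 = ((m + 1 : ℝ) ^ 3)⁻¹ := by
    rw [← Real.rpow_natCast, ← Real.rpow_mul hm.le, ← Real.rpow_natCast, ← Real.rpow_neg hm.le]
    norm_num
  rw [mul_pow, hpow, inv_mul_eq_div, le_div_iff₀ (by positivity)]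
  exact sq_jointFactor_zero_mul_le m

theorem qcount_succ_succ (m k : ℕ) :
    qcount (m + 1) (k + 1) =
      ((k + 1 : ℕ) : ℝ) * (Nat.choose (2 * (k + 1)) (k + 1) : ℝ) * jointFactor m k := by
  have h₁ : 4 * (m + 1) + 2 * (k + 1) - 5 = 4 * m + 2 * k + 1 := by lia
  have h₂ : 3 * (m + 1) + 2 * (k + 1) - 3 = 3 * m + 2 * k + 2 := by lia
  have hchoose : (Nat.choose (2 * (k + 1)) (k + 1) : ℝ) =
      (2 * (k + 1)).factorial / ((k + 1).factorial * (k + 1).factorial) := by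
    rw [Nat.cast_choose ℝ (by lia), show 2 * (k + 1) - (k + 1) = k + 1 by lia]
  have hfact : ((k + 1).factorial : ℝ) = ((k + 1 : ℕ) : ℝ) * k.factorial := by
    rw [Nat.factorial_succ, Nat.cast_mul]
  unfold qcount jointFactor
  rw [h₁, h₂, hchoose, Nat.add_sub_cancel, Nat.add_sub_cancel]
  simp only [Nat.cast_mul]
  rw [hfact]
  field_simp

/-- There is a constant `c > 0`, independent of `p` and `n`, with
`q_{n,p} ≤ c·C(p)·n^{−3/2}·(256/27)^n` for all `n ≥ 1` and `p ≥ 1`. -/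
theorem qcount_uniform_bound :
    ∃ c : ℝ, 0 < c ∧ ∀ n : ℕ, 1 ≤ n → ∀ p : ℕ, 1 ≤ p →
      qcount n p ≤ c * C p * (n : ℝ) ^ (-(3 : ℝ) / 2) * (256 / 27 : ℝ) ^ n := by
  have hC : 0 < Real.sqrt 3 / (32 * Real.sqrt (2 * Real.pi)) := by positivity
  refine ⟨(Real.sqrt 3 / (32 * Real.sqrt (2 * Real.pi)))⁻¹, inv_pos.mpr hC, fun n hn p hp => ?_⟩
  obtain ⟨m, rfl⟩ := Nat.exists_eq_add_of_le' hn
  obtain ⟨k, rfl⟩ := Nat.exists_eq_add_of_le' hp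
  have hjoint : jointFactor m k ≤ (16 / 9) ^ k *
      (((m + 1 : ℕ) : ℝ) ^ (-(3 : ℝ) / 2) * (256 / 27) ^ (m + 1)) := by
    calc jointFactor m k ≤ (16 / 9) ^ k * jointFactor m 0 := jointFactor_le_pow_mul m k
      _ ≤ (16 / 9) ^ k * (((m + 1 : ℕ) : ℝ) ^ (-(3 : ℝ) / 2) * (256 / 27) ^ m) := by
          push_cast
          gcongr
          exact jointFactor_zero_le m
      _ ≤ _ := by
          gcongr
          · norm_num
          · exact m.le_succ
  rw [qcount_succ_succ, C, Nat.add_sub_cancel, mul_assoc (Real.sqrt 3 / _),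
    mul_assoc (Real.sqrt 3 / _),
    inv_mul_cancel_left₀ hC.ne']
  refine (mul_le_mul_of_nonneg_left hjoint (by positivity)).trans_eq ?_
  ring
end

section
/- For every real x with 0 ≤ x < 1, the series Σ_{k=0}^{∞} θ(k)·x^k converges and Σ_{k=0}^{∞} θ(k)·x^k = 1 − (1 + 1/√(1−x))^{−2}. -/
open Filter Real

/-- The offspring distribution of the branching process encoding the skeleton
decomposition of quasi-simple triangulations:
`θ(k) = (3/2)·4^{−k}·(2k)!/(k!·(k+2)!)`. -/
noncomputable def theta (k : ℕ) : ℝ :=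
  3 / 2 * (4 : ℝ) ^ (-(k : ℤ)) * ((2 * k).factorial : ℝ) /
    ((k.factorial * (k + 2).factorial : ℕ) : ℝ)

theorem Ring.succ_mul_choose_succ (a : ℝ) (n : ℕ) :
    (n + 1) * Ring.choose a (n + 1) = (a - n) * Ring.choose a n := by
  have h (m : ℕ) : (m.factorial : ℝ) * Ring.choose a m = (descPochhammer ℤ m).smeval a := by
    rw [Ring.descPochhammer_eq_factorial_smul_choose, nsmul_eq_mul]
  have hn : (n.factorial : ℝ) ≠ 0 := by positivity
  have h_succ := h (n + 1)
  rw [descPochhammer_succ_right, Polynomial.smeval_mul, ← h n] at h_succ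
  simp only [Polynomial.smeval_sub, Polynomial.smeval_X, Polynomial.smeval_natCast, pow_one,
    pow_zero, nsmul_eq_mul, mul_one, Nat.factorial_succ, Nat.cast_mul, Nat.cast_add,
    Nat.cast_one] at h_succ
  apply mul_left_cancel₀ hn
  linear_combination h_succ

theorem theta_succ (k : ℕ) : theta (k + 1) * (k + 3) = theta k * (k + 1 / 2) := by
  have h_fact : ((2 * (k + 1)).factorial : ℝ) = (2 * k + 2) * (2 * k + 1) * (2 * k).factorial := by
    rw [show 2 * (k + 1) = 2 * k + 1 + 1 by ring, Nat.factorial_succ, Nat.factorial_succ]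
    push_cast
    ring
  simp only [theta, h_fact, show k + 1 + 2 = (k + 2) + 1 by ring, Nat.factorial_succ (k + 2),
    Nat.factorial_succ k, zpow_neg, zpow_natCast, pow_succ (4 : ℝ) k]
  have hk : (k.factorial : ℝ) ≠ 0 := by positivity
  have hk2 : ((k + 2).factorial : ℝ) ≠ 0 := by positivity
  push_cast
  field_simp
  ring

theorem theta_eq_choose (k : ℕ) :
    theta k = 2 * (-1) ^ k * Ring.choose (3 / 2 : ℝ) (k + 2) := by
  induction k with
  | zero =>
    have h := Ring.succ_mul_choose_succ (3 / 2) 1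
    norm_num at h
    norm_num [theta, Nat.factorial]
    linarith
  | succ k ih =>
    have h := Ring.succ_mul_choose_succ (3 / 2) (k + 2)
    have h_theta := theta_succ k
    have hk : (k : ℝ) + 3 ≠ 0 := by positivity
    apply mul_right_cancel₀ hk
    rw [h_theta, ih, show k + 1 + 2 = k + 2 + 1 by ring, pow_succ]
    push_cast at h
    linear_combination 2 * (-1) ^ k * h

theorem Real.hasSum_one_sub_rpow {x : ℝ} (hx : |x| < 1) (a : ℝ) :
    HasSum (fun n : ℕ => Ring.choose a n * (-x) ^ n) ((1 - x) ^ a) := by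
  have h := (Real.one_add_rpow_hasFPowerSeriesOnBall_zero (a := a)).hasSum (y := -x)
    (by simpa [enorm_eq_nnnorm, ← NNReal.coe_lt_coe] using hx)
  simpa [sub_eq_add_neg, binomialSeries, FormalMultilinearSeries.coeff_ofScalars, mul_comm] using h

/-- For `0 ≤ x < 1`, `Σ_{k≥0} θ(k)·x^k = 1 − (1 + 1/√(1−x))^{−2}`. -/
theorem theta_generating_series (x : ℝ) (hx0 : 0 ≤ x) (hx1 : x < 1) :
    HasSum (fun k : ℕ => theta k * x ^ k)
      (1 - (1 + 1 / Real.sqrt (1 - x)) ^ (-2 : ℤ)) := by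
  rcases hx0.eq_or_lt with rfl | hx
  · convert hasSum_single (f := fun k : ℕ => theta k * (0 : ℝ) ^ k) 0 (by simp +contextual) using 1
    norm_num [theta, Nat.factorial]
  have h := (hasSum_nat_add_iff' 2).2
    (Real.hasSum_one_sub_rpow (by rwa [abs_of_pos hx]) (3 / 2))
  convert! h.mul_left (2 / x ^ 2) using 1
  · ext k
    rw [theta_eq_choose, pow_add, neg_pow x k]
    field_simp
  · have hs : 0 < √(1 - x) := Real.sqrt_pos.2 (by linarith)
    have h_sq : √(1 - x) ^ 2 = 1 - x := Real.sq_sqrt (by linarith)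
    have h_rpow : (1 - x) ^ (3 / 2 : ℝ) = √(1 - x) ^ 3 := by
      rw [Real.sqrt_eq_rpow, ← Real.rpow_mul_natCast (by linarith)]
      norm_num
    simp only [Finset.sum_range_succ, Finset.sum_range_zero, Ring.choose_zero_right,
      Ring.choose_one_right, h_rpow]
    generalize √(1 - x) = s at hs h_sq
    obtain rfl : x = 1 - s ^ 2 := by linarith
    have hx' : 1 - s ^ 2 ≠ 0 := hx.ne'
    rw [zpow_neg]
    norm_cast
    field_simp
    ring
end

section
/- For all fixed integers p ≥ 1, q ≥ 1 and m ≥ 0, the ratio q_{n−m,q} / q_{n,p} converges as n → ∞ (over n with n − m ≥ 1) to (C(q)/C(p))·(27/256)^{m}. -/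
open Filter Real

theorem qcount_succ_succ_s10 (n p : ℕ) :
    qcount (n + 1) (p + 1) = ((2 * p + 2).factorial * (4 * n + 2 * p + 1).factorial : ℝ) /
      (p.factorial * (p + 1).factorial * n.factorial * (3 * n + 2 * p + 2).factorial) := by
  have h₁ : 4 * (n + 1) + 2 * (p + 1) - 5 = 4 * n + 2 * p + 1 := by omega
  have h₂ : 3 * (n + 1) + 2 * (p + 1) - 3 = 3 * n + 2 * p + 2 := by omega
  simp only [qcount, h₁, h₂, Nat.add_sub_cancel]
  push_cast
  rfl

theorem qcount_pos (n p : ℕ) : 0 < qcount n p := by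
  unfold qcount
  positivity

theorem C_succ_pos (p : ℕ) : 0 < C (p + 1) := by
  have h : 0 < Nat.choose (2 * (p + 1)) (p + 1) := Nat.choose_pos (by omega)
  have := Real.pi_pos
  unfold C
  positivity

theorem C_succ_ratio (p : ℕ) :
    C (p + 2) / C (p + 1) = (2 * p + 4) * (2 * p + 3) / ((p + 1) * (p + 2)) * (16 / 9) := by
  have h : ((p : ℝ) + 2) * (Nat.choose (2 * (p + 2)) (p + 2) : ℝ) =
      2 * (2 * p + 3) * (Nat.choose (2 * (p + 1)) (p + 1) : ℝ) := by
    have := Nat.succ_mul_centralBinom_succ (p + 1)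
    simp only [Nat.centralBinom] at this
    have h' := congrArg (Nat.cast : ℕ → ℝ) this
    push_cast at h'
    linear_combination h'
  rw [div_eq_iff (C_succ_pos p).ne']
  simp only [C, show p + 2 - 1 = p + 1 by omega, Nat.add_sub_cancel, pow_succ]
  push_cast
  field_simp
  linear_combination (p + 2 : ℝ) * h

theorem qcount_succ_right_ratio (n p : ℕ) :
    qcount (n + 1) (p + 2) / qcount (n + 1) (p + 1) =
      (2 * p + 4) * (2 * p + 3) / ((p + 1) * (p + 2)) *
        (((2 * p + 3 + 4 * n) / (2 * p + 4 + 3 * n)) *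
          ((2 * p + 2 + 4 * n) / (2 * p + 3 + 3 * n)) : ℝ) := by
  rw [div_eq_iff (qcount_pos _ _).ne', qcount_succ_succ_s10 n p, qcount_succ_succ_s10 n (p + 1),
    show 2 * (p + 1) + 2 = 2 * p + 2 + 1 + 1 by ring,
    show 4 * n + 2 * (p + 1) + 1 = 4 * n + 2 * p + 1 + 1 + 1 by ring,
    show 3 * n + 2 * (p + 1) + 2 = 3 * n + 2 * p + 2 + 1 + 1 by ring]
  simp only [Nat.factorial_succ (2 * p + 2 + 1), Nat.factorial_succ (2 * p + 2),
    Nat.factorial_succ (4 * n + 2 * p + 1 + 1), Nat.factorial_succ (4 * n + 2 * p + 1),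
    Nat.factorial_succ (3 * n + 2 * p + 2 + 1), Nat.factorial_succ (3 * n + 2 * p + 2),
    Nat.factorial_succ (p + 1), Nat.factorial_succ p]
  push_cast
  field_simp
  ring

theorem qcount_succ_left_ratio (n p : ℕ) :
    qcount (n + 1) (p + 1) / qcount (n + 1 + 1) (p + 1) =
      (((1 + 1 * n) / (2 * p + 5 + 4 * n)) * ((2 * p + 5 + 3 * n) / (2 * p + 4 + 4 * n)) *
        ((2 * p + 4 + 3 * n) / (2 * p + 3 + 4 * n)) *
          ((2 * p + 3 + 3 * n) / (2 * p + 2 + 4 * n)) : ℝ) := by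
  rw [div_eq_iff (qcount_pos _ _).ne', qcount_succ_succ_s10 n p, qcount_succ_succ_s10 (n + 1) p,
    show 4 * (n + 1) + 2 * p + 1 = 4 * n + 2 * p + 1 + 1 + 1 + 1 + 1 by ring,
    show 3 * (n + 1) + 2 * p + 2 = 3 * n + 2 * p + 2 + 1 + 1 + 1 by ring]
  simp only [Nat.factorial_succ (4 * n + 2 * p + 1 + 1 + 1 + 1),
    Nat.factorial_succ (4 * n + 2 * p + 1 + 1 + 1),
    Nat.factorial_succ (4 * n + 2 * p + 1 + 1), Nat.factorial_succ (4 * n + 2 * p + 1),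
    Nat.factorial_succ (3 * n + 2 * p + 2 + 1 + 1),
    Nat.factorial_succ (3 * n + 2 * p + 2 + 1), Nat.factorial_succ (3 * n + 2 * p + 2),
    Nat.factorial_succ n]
  push_cast
  field_simp
  ring

theorem tendsto_qcount_succ_right_ratio (p : ℕ) :
    Tendsto (fun n : ℕ => qcount n (p + 2) / qcount n (p + 1)) atTop
      (nhds (C (p + 2) / C (p + 1))) := by
  rw [← tendsto_add_atTop_iff_nat 1, C_succ_ratio]
  simp only [qcount_succ_right_ratio]
  refine Tendsto.const_mul _ ?_
  rw [show (16 / 9 : ℝ) = 4 / 3 * (4 / 3) by norm_num]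
  exact (tendsto_add_mul_div_add_mul_atTop_nhds _ _ 4 three_ne_zero).mul
    (tendsto_add_mul_div_add_mul_atTop_nhds _ _ 4 three_ne_zero)

theorem tendsto_qcount_succ_left_ratio (p : ℕ) :
    Tendsto (fun n : ℕ => qcount n (p + 1) / qcount (n + 1) (p + 1)) atTop
      (nhds (27 / 256)) := by
  rw [← tendsto_add_atTop_iff_nat 1]
  simp only [qcount_succ_left_ratio]
  rw [show (27 / 256 : ℝ) = 1 / 4 * (3 / 4) * (3 / 4) * (3 / 4) by norm_num]
  exact (((tendsto_add_mul_div_add_mul_atTop_nhds _ _ 1 four_ne_zero).mul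
    (tendsto_add_mul_div_add_mul_atTop_nhds _ _ 3 four_ne_zero)).mul
    (tendsto_add_mul_div_add_mul_atTop_nhds _ _ 3 four_ne_zero)).mul
    (tendsto_add_mul_div_add_mul_atTop_nhds _ _ 3 four_ne_zero)

theorem tendsto_qcount_div_qcount_one (p : ℕ) :
    Tendsto (fun n : ℕ => qcount n (p + 1) / qcount n 1) atTop (nhds (C (p + 1) / C 1)) := by
  induction p with
  | zero =>
    simp only [zero_add, div_self (qcount_pos _ _).ne', div_self (C_succ_pos 0).ne']
    exact tendsto_const_nhds
  | succ p ih =>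
    have h := (tendsto_qcount_succ_right_ratio p).mul ih
    rw [div_mul_div_cancel₀ (C_succ_pos p).ne'] at h
    exact h.congr fun n => div_mul_div_cancel₀ (qcount_pos _ _).ne'

theorem tendsto_qcount_div_qcount_add (p m : ℕ) :
    Tendsto (fun n : ℕ => qcount n (p + 1) / qcount (n + m) (p + 1)) atTop
      (nhds ((27 / 256) ^ m)) := by
  induction m with
  | zero =>
    simp only [add_zero, div_self (qcount_pos _ _).ne', pow_zero]
    exact tendsto_const_nhds
  | succ m ih =>
    rw [pow_succ]
    have h := ih.mul ((tendsto_add_atTop_iff_nat m).2 (tendsto_qcount_succ_left_ratio p))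
    exact h.congr fun n => div_mul_div_cancel₀ (qcount_pos _ _).ne'

/-- For fixed `p ≥ 1`, `q' ≥ 1` and `m ≥ 0`, the ratio `q_{n−m,q'} / q_{n,p}` converges
to `(C(q')/C(p))·(27/256)^m` as `n → ∞`. -/
theorem qcount_ratio_limit (p q' m : ℕ) (hp : 1 ≤ p) (hq : 1 ≤ q') :
    Tendsto (fun n : ℕ => qcount (n - m) q' / qcount n p)
      atTop (nhds (C q' / C p * (27 / 256 : ℝ) ^ m)) := by
  obtain ⟨p, rfl⟩ := Nat.exists_eq_add_of_le' hp
  obtain ⟨q', rfl⟩ := Nat.exists_eq_add_of_le' hq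
  rw [← tendsto_add_atTop_iff_nat m]
  simp only [Nat.add_sub_cancel]
  have hC := (C_succ_pos 0).ne'
  have hCp := (C_succ_pos p).ne'
  have h := ((tendsto_qcount_div_qcount_one q').div (tendsto_qcount_div_qcount_one p)
    (div_ne_zero hCp hC)).mul (tendsto_qcount_div_qcount_add p m)
  rw [div_div_div_cancel_right₀ hC] at h
  refine h.congr fun n => ?_
  rw [Pi.div_apply, div_div_div_cancel_right₀ (qcount_pos _ _).ne',
    div_mul_div_cancel₀ (qcount_pos _ _).ne']
end

section
/- Let (p_i)_{i≥0} be a sequence of strictly positive real numbers such that there exist constants a > 0 and b > 0 with p_i ≤ a·e^{−b·i} for all i ≥ 0. Then there exist constants a′ > 0 and b′ > 0 and an infinite subset N′ ⊆ ℕ such that for every k ∈ N′ and every integer i ≥ 0, Σ_{j ≥ k+i} p_j ≤ a′·e^{−b′·i}·Σ_{j ≥ k} p_j. (Equivalently, for a random variable X on ℕ with ℙ(X = i) = p_i / Σ_j p_j strictly positive for all i and with exponential tails: for k in an infinite set of integers, ℙ(X ≥ k+i | X ≥ k) ≤ a′·e^{−b′·i} for all i ≥ 0.) -/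
open Filter Real

/-- A positive real sequence tending to zero has infinitely many indices at which it dominates all
of its later terms. -/
theorem infinite_setOf_forall_add_le {u : ℕ → ℝ} (hu : ∀ k, 0 < u k)
    (hlim : Tendsto u atTop (nhds 0)) : {k | ∀ i, u (k + i) ≤ u k}.Infinite := by
  refine Set.infinite_of_forall_exists_gt fun n => ?_
  have h_shift : Tendsto (fun j => u (n + 1 + j)) atTop (nhds 0) := by
    simpa only [add_comm (n + 1)] using (tendsto_add_atTop_iff_nat (n + 1)).2 hlim
  have h_ev : ∀ᶠ j in cocompact ℕ, u (n + 1 + j) ≤ u (n + 1 + 0) := by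
    rw [cocompact_eq_cofinite, Nat.cofinite_eq_atTop]
    exact h_shift.eventually_le_const (hu _)
  obtain ⟨m, hm⟩ := (continuous_of_discreteTopology (f := fun j => u (n + 1 + j))).exists_forall_ge' 0
    h_ev
  exact ⟨n + 1 + m, fun i => by simpa only [add_assoc] using hm (m + i), by lia⟩

/-- Tail-ratio lemma: if `(p_i)` are strictly positive with `p_i ≤ a·e^{−b·i}`,
then there exist `a' > 0`, `b' > 0` and an infinite set `N' ⊆ ℕ` such that for
every `k ∈ N'` and every `i ≥ 0`,
`Σ_{j ≥ k+i} p_j ≤ a'·e^{−b'·i}·Σ_{j ≥ k} p_j`. -/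
theorem tail_ratio_lemma (p : ℕ → ℝ) (hp : ∀ i, 0 < p i)
    (a b : ℝ) (ha : 0 < a) (hb : 0 < b)
    (hbound : ∀ i : ℕ, p i ≤ a * Real.exp (-b * i)) :
    ∃ a' : ℝ, 0 < a' ∧ ∃ b' : ℝ, 0 < b' ∧ ∃ N' : Set ℕ, N'.Infinite ∧
      ∀ k ∈ N', ∀ i : ℕ,
        (∑' j : ℕ, if k + i ≤ j then p j else 0) ≤
          a' * Real.exp (-b' * i) * (∑' j : ℕ, if k ≤ j then p j else 0) := by
  have h_sum (c : ℝ) (hc : 0 < c) : Summable fun j : ℕ => a * exp (-c * j) := by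
    refine Summable.mul_left a ?_
    simpa only [mul_comm] using summable_exp_nat_mul_iff.2 (neg_lt_zero.2 hc)
  have hps : Summable p := .of_nonneg_of_le (fun i => (hp i).le) hbound (h_sum b hb)
  have h_ite (k j : ℕ) : 0 ≤ if k ≤ j then p j else 0 := by
    split_ifs
    exacts [(hp j).le, le_rfl]
  have h_tail (k : ℕ) : Summable fun j => if k ≤ j then p j else 0 := by
    refine .of_nonneg_of_le (h_ite k) (fun j => ?_) hps
    split_ifs
    exacts [le_rfl, (hp j).le]
  set T : ℕ → ℝ := fun k => ∑' j : ℕ, if k ≤ j then p j else 0 with hT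
  have hTpos (k : ℕ) : 0 < T k := (h_tail k).tsum_pos (h_ite k) k (by simpa using hp k)
  have hlim : Tendsto (fun k : ℕ => exp (b / 2 * k) * T k) atTop (nhds 0) := by
    simp only [hT, ← tsum_mul_left]
    suffices h : Tendsto (fun k : ℕ => ∑' j : ℕ, exp (b / 2 * k) * if k ≤ j then p j else 0) atTop
        (nhds (∑' _ : ℕ, (0 : ℝ))) by
      rwa [tsum_zero] at h
    refine tendsto_tsum_of_dominated_convergence (h_sum (b / 2) (half_pos hb)) (fun j => ?_)
      (.of_forall fun k j => ?_)
    · refine tendsto_const_nhds.congr' ?_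
      filter_upwards [eventually_gt_atTop j] with k hk
      simp [hk.not_ge]
    · rw [norm_of_nonneg (mul_nonneg (exp_pos _).le (h_ite k j))]
      split_ifs with hkj
      · calc exp (b / 2 * k) * p j ≤ exp (b / 2 * j) * (a * exp (-b * j)) := by
              gcongr
              exacts [(hp j).le, hbound j]
          _ = a * exp (-(b / 2) * j) := by
              rw [mul_left_comm, ← exp_add]
              ring_nf
      · rw [mul_zero]
        positivity
  refine ⟨1, one_pos, b / 2, half_pos hb, _,
    infinite_setOf_forall_add_le (fun k => mul_pos (exp_pos _) (hTpos k)) hlim, fun k hk i => ?_⟩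
  change T (k + i) ≤ 1 * exp (-(b / 2) * i) * T k
  have h_le := hk i
  refine le_of_mul_le_mul_left (h_le.trans_eq ?_) (exp_pos (b / 2 * (k + i : ℕ)))
  rw [one_mul, ← mul_assoc, ← exp_add]
  push_cast
  ring_nf
end
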